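/- Diaconis–Shahshahani entropy bound: let N ≥ 1 and let μ be a probability distribution on ZMod N. Then for every n ≥ 1 the Shannon entropy of the n-fold convolution power satisfies H(μ^{⋆n}) ≥ log₂ N − (log₂ N + 1) · √( ∑_{k ≠ 0} |μ̂(k)|^{2n} ). -/

import Mathlib

open Filter

/-- Convolution of two functions on the cycle group `ZMod N`. -/
noncomputable def cycleConv {N : ℕ} [NeZero N] (μ ν : ZMod N → ℝ) : ZMod N → ℝ :=
  fun x => ∑ y : ZMod N, μ (x - y) * ν y

/-- `n`-fold convolution power of `μ` (with `μ^{⋆0} = δ₀`, so `μ^{⋆1} = μ`). -/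
noncomputable def cycleConvPow {N : ℕ} [NeZero N] (μ : ZMod N → ℝ) : ℕ → ZMod N → ℝ
  | 0 => fun x => if x = 0 then 1 else 0
  | n + 1 => cycleConv μ (cycleConvPow μ n)

/-- Fourier coefficient of `μ : ZMod N → ℝ`:
`μ̂(k) = ∑ s, μ(s) · exp(−2πi · k.val · s.val / N)`. -/
noncomputable def cycleFourier {N : ℕ} [NeZero N] (μ : ZMod N → ℝ) (k : ZMod N) : ℂ :=
  ∑ s : ZMod N, (μ s : ℂ) *
    Complex.exp (-(2 * (Real.pi : ℂ) * Complex.I * (k.val : ℂ) * (s.val : ℂ)) / (N : ℂ))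

/-- Shannon entropy (base 2) of a distribution on `ZMod N`, with `0 · log₂ 0 = 0`
(automatic since `Real.logb 2 0 = 0`). -/
noncomputable def shannonEntropy {N : ℕ} [NeZero N] (p : ZMod N → ℝ) : ℝ :=
  -∑ x : ZMod N, p x * Real.logb 2 (p x)

theorem cycleFourier_eq_sum_stdAddChar {N : ℕ} [NeZero N] (μ : ZMod N → ℝ) (k : ZMod N) :
    cycleFourier μ k = ∑ s : ZMod N, (μ s : ℂ) * ZMod.stdAddChar (-(s * k)) := by
  refine Finset.sum_congr rfl fun s _ => ?_
  have h : (-(s * k) : ZMod N) = ((-(s.val * k.val : ℤ) : ℤ) : ZMod N) := by simp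
  rw [h, ZMod.stdAddChar_coe]
  congr 2
  push_cast
  ring

theorem cycleFourier_zero {N : ℕ} [NeZero N] (μ : ZMod N → ℝ) :
    cycleFourier μ 0 = ((∑ x, μ x : ℝ) : ℂ) := by
  simp [cycleFourier_eq_sum_stdAddChar]

theorem cycleFourier_cycleConv {N : ℕ} [NeZero N] (μ ν : ZMod N → ℝ) (k : ZMod N) :
    cycleFourier (cycleConv μ ν) k = cycleFourier μ k * cycleFourier ν k := by
  simp only [cycleFourier_eq_sum_stdAddChar, cycleConv, Complex.ofReal_sum, Complex.ofReal_mul,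
    Finset.sum_mul]
  rw [Finset.sum_comm]
  simp only [Finset.mul_sum]
  rw [Finset.sum_comm (f := fun i j => (μ i : ℂ) * _ * _)]
  refine Finset.sum_congr rfl fun y _ => ?_
  rw [← Equiv.sum_comp (Equiv.addRight y)]
  refine Finset.sum_congr rfl fun x _ => ?_
  have h : -((x + y) * k) = -(x * k) + -(y * k) := by ring
  simp only [Equiv.coe_addRight, add_sub_cancel_right, h, AddChar.map_add_eq_mul]
  ring

theorem cycleFourier_cycleConvPow {N : ℕ} [NeZero N] (μ : ZMod N → ℝ) (n : ℕ) (k : ZMod N) :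
    cycleFourier (cycleConvPow μ n) k = cycleFourier μ k ^ n := by
  induction n with
  | zero => simp [cycleFourier_eq_sum_stdAddChar, cycleConvPow, apply_ite Complex.ofReal]
  | succ n ih => rw [cycleConvPow, cycleFourier_cycleConv, ih, pow_succ']

theorem cycleConvPow_nonneg {N : ℕ} [NeZero N] {μ : ZMod N → ℝ} (hpos : ∀ x, 0 ≤ μ x)
    (n : ℕ) (x : ZMod N) : 0 ≤ cycleConvPow μ n x := by
  induction n generalizing x with
  | zero => simp only [cycleConvPow]; split_ifs <;> norm_num
  | succ n ih => exact Finset.sum_nonneg fun y _ => mul_nonneg (hpos _) (ih y)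

theorem sum_cycleConvPow {N : ℕ} [NeZero N] {μ : ZMod N → ℝ} (hsum : ∑ x, μ x = 1) (n : ℕ) :
    ∑ x, cycleConvPow μ n x = 1 := by
  have h := cycleFourier_cycleConvPow μ n 0
  rw [cycleFourier_zero, cycleFourier_zero, hsum, Complex.ofReal_one, one_pow] at h
  exact_mod_cast h

/-- Parseval's identity on `ZMod N`. -/
theorem sum_norm_cycleFourier_sq {N : ℕ} [NeZero N] (p : ZMod N → ℝ) :
    ∑ k, ‖cycleFourier p k‖ ^ 2 = N * ∑ x, p x ^ 2 := by
  have hdft : ZMod.dft (fun x => (p x : ℂ)) = cycleFourier p := by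
    ext k
    simp [ZMod.dft_apply, cycleFourier_eq_sum_stdAddChar, mul_comm]
  have hinv := ZMod.dft_dft (fun x => (p x : ℂ))
  rw [hdft] at hinv
  have hconj (k : ZMod N) : starRingEnd ℂ (cycleFourier p k) =
      ∑ s, (p s : ℂ) * ZMod.stdAddChar (s * k) := by
    simp [cycleFourier_eq_sum_stdAddChar, ← AddChar.map_neg_eq_conj]
  have h : ∑ k, cycleFourier p k * starRingEnd ℂ (cycleFourier p k) =
      N * ∑ x, (p x : ℂ) ^ 2 := by
    simp only [hconj, Finset.mul_sum]
    rw [Finset.sum_comm]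
    refine Finset.sum_congr rfl fun s _ => ?_
    have := congrFun hinv (-s)
    simp only [ZMod.dft_apply, smul_eq_mul, neg_neg, mul_neg] at this
    calc _ = (p s : ℂ) * ∑ k, ZMod.stdAddChar (k * s) * cycleFourier p k := by
          rw [Finset.mul_sum]
          refine Finset.sum_congr rfl fun k _ => ?_
          rw [mul_comm s k]
          ring
      _ = _ := by rw [this]; ring
  simp only [Complex.mul_conj'] at h
  exact_mod_cast h

theorem shannonEntropy_nonneg {N : ℕ} [NeZero N] {p : ZMod N → ℝ} (hpos : ∀ x, 0 ≤ p x)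
    (hsum : ∑ x, p x = 1) : 0 ≤ shannonEntropy p := by
  refine neg_nonneg.2 (Finset.sum_nonpos fun x _ => ?_)
  have hle : p x ≤ 1 := hsum ▸ Finset.single_le_sum (fun y _ => hpos y) (Finset.mem_univ x)
  exact mul_nonpos_of_nonneg_of_nonpos (hpos x)
    (Real.logb_nonpos one_lt_two (hpos x) hle)

/-- The relative entropy to the uniform distribution is at most the chi-square divergence. -/
theorem logb_sub_shannonEntropy_le {N : ℕ} [NeZero N] {p : ZMod N → ℝ} (hpos : ∀ x, 0 ≤ p x)
    (hsum : ∑ x, p x = 1) :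
    Real.logb 2 N - shannonEntropy p ≤ (N * ∑ x, p x ^ 2 - 1) / Real.log 2 := by
  have hN : (N : ℝ) ≠ 0 := NeZero.ne _
  have key (x : ZMod N) : p x * (Real.log N + Real.log (p x)) ≤ p x * (N * p x - 1) := by
    rcases (hpos x).eq_or_lt with h | h
    · simp [← h]
    · rw [← Real.log_mul hN h.ne']
      exact mul_le_mul_of_nonneg_left (Real.log_le_sub_one_of_pos (by positivity)) h.le
  have hl : Real.logb 2 N - shannonEntropy p =
      (∑ x, p x * (Real.log N + Real.log (p x))) / Real.log 2 := by
    simp only [shannonEntropy, Real.logb, mul_add, Finset.sum_add_distrib, ← Finset.sum_mul, hsum,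
      ← mul_div_assoc, ← Finset.sum_div]
    ring
  have hr : ∑ x, p x * (N * p x - 1) = N * ∑ x, p x ^ 2 - 1 := by
    nth_rw 2 [← hsum]
    rw [Finset.mul_sum, ← Finset.sum_sub_distrib]
    exact Finset.sum_congr rfl fun x _ => by ring
  rw [hl, ← hr]
  exact div_le_div_of_nonneg_right (Finset.sum_le_sum fun x _ => key x)
    (Real.log_pos one_lt_two).le

/-- Diaconis–Shahshahani entropy bound: for every `n ≥ 1`, the Shannon entropy of the
`n`-fold convolution power satisfies
`H(μ^{⋆n}) ≥ log₂ N − (log₂ N + 1) · √( ∑_{k ≠ 0} |μ̂(k)|^{2n} )`. -/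
theorem diaconis_shahshahani_entropy_bound
    (N : ℕ) [NeZero N] (hN : 1 ≤ N) (μ : ZMod N → ℝ)
    (hpos : ∀ x, 0 ≤ μ x) (hsum : ∑ x : ZMod N, μ x = 1)
    (n : ℕ) (hn : 1 ≤ n) :
    shannonEntropy (cycleConvPow μ n) ≥
      Real.logb 2 (N : ℝ) - (Real.logb 2 (N : ℝ) + 1) *
        Real.sqrt (∑ k ∈ Finset.univ.filter (fun k : ZMod N => k ≠ 0),
          ‖cycleFourier μ k‖ ^ (2 * n)) := by
  have hp := cycleConvPow_nonneg hpos n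
  have hs := sum_cycleConvPow hsum n
  have hD := logb_sub_shannonEntropy_le hp hs
  have hH := shannonEntropy_nonneg hp hs
  have hchi : N * ∑ x, cycleConvPow μ n x ^ 2 - 1 =
      ∑ k ∈ Finset.univ.filter (fun k : ZMod N => k ≠ 0), ‖cycleFourier μ k‖ ^ (2 * n) := by
    rw [← sum_norm_cycleFourier_sq, Finset.filter_ne', ← Finset.sum_erase_add _ _
      (Finset.mem_univ (0 : ZMod N)), cycleFourier_zero, hs]
    simp [cycleFourier_cycleConvPow, ← pow_mul, mul_comm]
  rw [hchi] at hD
  set S := ∑ k ∈ Finset.univ.filter (fun k : ZMod N => k ≠ 0), ‖cycleFourier μ k‖ ^ (2 * n)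
    with hS
  have hS0 : 0 ≤ S := Finset.sum_nonneg fun k _ => by positivity
  have ht := Real.sqrt_nonneg S
  have hsq := Real.sq_sqrt hS0
  have hL : 0 ≤ Real.logb 2 N := Real.logb_nonneg one_lt_two (by exact_mod_cast hN)
  rcases le_or_gt 1 (√S) with h1 | h1
  · nlinarith
  rcases hN.eq_or_lt with rfl | hN2
  · have h0 : S = 0 := by
      rw [hS, Finset.filter_false_of_mem fun k _ => by simpa using Subsingleton.elim k 0,
        Finset.sum_empty]
    simpa [h0] using hH
  · have hL1 : 1 ≤ Real.logb 2 N := by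
      rw [Real.le_logb_iff_rpow_le one_lt_two (by positivity)]
      simpa using (Nat.cast_le (α := ℝ)).2 hN2
    have hlog : S / Real.log 2 ≤ 2 * S := by
      rw [div_le_iff₀ (Real.log_pos one_lt_two)]
      nlinarith [Real.log_two_gt_d9]
    nlinarith
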